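/- arXiv:1509.00438 — 4 statements merged into one kernel-verified Lean document; each statement's English description precedes it below -/
import Mathlib

section
/- For every n ≥ 2, the operators U_1, …, U_{n−1} on V^{⊗n} satisfy the Temperley-Lieb relations: (1) U_i² = −(q+q⁻¹)·U_i for all i; (2) U_i∘U_j = U_j∘U_i whenever |i−j| > 1; (3) U_i∘U_j∘U_i = U_i whenever |i−j| = 1. -/
set_option maxHeartbeats 1000000
set_option synthInstance.maxHeartbeats 400000

/-! Common setup: `Fq = ℚ(q)`, the tensor power `V^{⊗n}` of `V = Fq²` realized as
functions on the set of `{0,1}`-sequences (its standard basis), the Temperley-Lieb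
and braid operators `U_i, t_i, t_i'`, the quantum `sl₂` operators `E, F, K^{⊗n}`,
weight spaces, quantum integers and the Jones-Wenzl operators. -/

noncomputable section

/-- The field `ℚ(q)` of rational functions. -/
abbrev Fq := RatFunc ℚ

/-- The variable `q`. -/
def q : Fq := RatFunc.X

/-- `V^{⊗n}` for `V = Fq²`: functions on the index set of the standard basis
`v_{i₁} ⊗ ⋯ ⊗ v_{iₙ}`, `i_r ∈ {0,1}` (here `false ↔ v₀`, `true ↔ v₁`). -/
abbrev Tens (n : ℕ) := (Fin n → Bool) → Fq

/-- Coefficients of `Ũ` on `V ⊗ V`: `uCoef a b c d` is the coefficient of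
`v_c ⊗ v_d` in `Ũ(v_a ⊗ v_b)`. -/
def uCoef : Bool → Bool → Bool → Bool → Fq
  | false, true, true, false => 1
  | false, true, false, true => -q
  | true, false, true, false => -q⁻¹
  | true, false, false, true => 1
  | _, _, _, _ => 0

/-- Coefficients of `t̃` on `V ⊗ V`. -/
def tCoef : Bool → Bool → Bool → Bool → Fq
  | false, false, false, false => 1
  | true, true, true, true => 1
  | false, true, true, false => q
  | false, true, false, true => 1 - q ^ 2
  | true, false, false, true => q
  | _, _, _, _ => 0

/-- Coefficients of `t̃′` on `V ⊗ V`. -/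
def tpCoef : Bool → Bool → Bool → Bool → Fq
  | false, false, false, false => 1
  | true, true, true, true => 1
  | false, true, true, false => q⁻¹
  | true, false, true, false => 1 - (q ^ 2)⁻¹
  | true, false, false, true => q⁻¹
  | _, _, _, _ => 0

/-- Matrix of the operator `id^{⊗(i-1)} ⊗ T ⊗ id^{⊗(n-i-1)}` acting on the
(1-based) tensor factors `i, i+1` of `V^{⊗n}`, where `T` has coefficient matrix `m`:
the `(t, s)` entry is the coefficient of the basis vector indexed by `t` in the image
of the basis vector indexed by `s`. -/
def locMat (n : ℕ) (m : Bool → Bool → Bool → Bool → Fq) (i : ℕ) :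
    Matrix (Fin n → Bool) (Fin n → Bool) Fq := fun t s =>
  if h : 1 ≤ i ∧ i < n then
    let i0 : Fin n := ⟨i - 1, by omega⟩
    let i1 : Fin n := ⟨i, by omega⟩
    if s = Function.update (Function.update t i0 (s i0)) i1 (s i1) then
      m (s i0) (s i1) (t i0) (t i1)
    else 0
  else 0

/-- The Temperley-Lieb operator `U_i = id^{⊗(i-1)} ⊗ Ũ ⊗ id^{⊗(n-i-1)}` (1-based `i`). -/
def Uop (n i : ℕ) : Module.End Fq (Tens n) := (locMat n uCoef i).mulVecLin

/-- The braid operator `t_i = id^{⊗(i-1)} ⊗ t̃ ⊗ id^{⊗(n-i-1)}` (1-based `i`). -/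
def tOp (n i : ℕ) : Module.End Fq (Tens n) := (locMat n tCoef i).mulVecLin

/-- The inverse braid operator `t_i′ = id^{⊗(i-1)} ⊗ t̃′ ⊗ id^{⊗(n-i-1)}` (1-based `i`). -/
def tpOp (n i : ℕ) : Module.End Fq (Tens n) := (locMat n tpCoef i).mulVecLin

/-- Number of indices `r` with `i_r = 1` in the basis index `s`. -/
def countOnes {n : ℕ} (s : Fin n → Bool) : ℕ := (Finset.univ.filter fun r => s r = true).card

/-- The weight space `W_k = V₁^{⊗n}[-n+2k]`: the span of the standard basis vectors
with exactly `k` of the `i_r` equal to `1`. -/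
def weightSpace (n k : ℕ) : Submodule Fq (Tens n) :=
  Submodule.span Fq {ψ : Tens n | ∃ s : Fin n → Bool, countOnes s = k ∧ ψ = Pi.single s 1}

/-- Eigenvalue of `K` on `v_b`. -/
def kval (b : Bool) : Fq := if b then q else q⁻¹

/-- Matrix of `E = Σ_j K^{⊗(j-1)} ⊗ e ⊗ id^{⊗(n-j)}` on `V^{⊗n}`. -/
def Emat (n : ℕ) : Matrix (Fin n → Bool) (Fin n → Bool) Fq := fun t s =>
  ∑ j : Fin n,
    if s j = false ∧ t = Function.update s j true then
      ∏ r ∈ Finset.univ.filter fun r => r < j, kval (s r)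
    else 0

/-- Matrix of `F = Σ_j id^{⊗(j-1)} ⊗ f ⊗ (K⁻¹)^{⊗(n-j)}` on `V^{⊗n}`. -/
def Fmat (n : ℕ) : Matrix (Fin n → Bool) (Fin n → Bool) Fq := fun t s =>
  ∑ j : Fin n,
    if s j = true ∧ t = Function.update s j false then
      ∏ r ∈ Finset.univ.filter fun r => j < r, (kval (s r))⁻¹
    else 0

/-- The operator `E` on `V^{⊗n}`. -/
def Eop (n : ℕ) : Module.End Fq (Tens n) := (Emat n).mulVecLin

/-- The operator `F` on `V^{⊗n}`. -/
def Fop (n : ℕ) : Module.End Fq (Tens n) := (Fmat n).mulVecLin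

/-- The operator `𝐊 = K^{⊗n}` on `V^{⊗n}`. -/
def Kop (n : ℕ) : Module.End Fq (Tens n) :=
  (Matrix.diagonal fun s : Fin n → Bool => ∏ r, kval (s r)).mulVecLin

/-- The operator `𝐊⁻¹ = (K⁻¹)^{⊗n}` on `V^{⊗n}`. -/
def Kinvop (n : ℕ) : Module.End Fq (Tens n) :=
  (Matrix.diagonal fun s : Fin n → Bool => (∏ r, kval (s r))⁻¹).mulVecLin

/-- The quantum integer `[m] = (q^m - q^{-m})/(q - q⁻¹)`. -/
def qint (m : ℕ) : Fq := (q ^ m - q⁻¹ ^ m) / (q - q⁻¹)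

/-- The quantum factorial `[m]! = [1][2]⋯[m]`. -/
def qfact (m : ℕ) : Fq := ∏ i ∈ Finset.range m, qint (i + 1)

/-- The quantum binomial coefficient `[n choose k] = [n]!/([k]!·[n-k]!)`. -/
def qbinom (n k : ℕ) : Fq := qfact n / (qfact k * qfact (n - k))

/-- The divided power `E^{(k)} = E^k/[k]!`. -/
def Ediv (n k : ℕ) : Module.End Fq (Tens n) := (qfact k)⁻¹ • (Eop n) ^ k

/-- The divided power `F^{(k)} = F^k/[k]!`. -/
def Fdiv (n k : ℕ) : Module.End Fq (Tens n) := (qfact k)⁻¹ • (Fop n) ^ k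

/-- The operator `P_k = (1/[n choose k])·E^{(k)} ∘ F^{(k)}` (the Jones-Wenzl projector
on the weight space `W_k`). -/
def JW (n k : ℕ) : Module.End Fq (Tens n) := (qbinom n k)⁻¹ • (Ediv n k ∘ₗ Fdiv n k)

/-- The vectors `l_r` (1-based): `l_r = v₀^{⊗(r-1)} ⊗ (v₁⊗v₀ - q·v₀⊗v₁) ⊗ v₀^{⊗(n-r-1)}`
for `r ≠ n`, and `l_n = v₀^{⊗(n-1)} ⊗ v₁`. -/
def ell (n j : ℕ) : Tens n :=
  if j = n then Pi.single (fun r => decide (r.val = n - 1)) 1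
  else (Pi.single (fun r => decide (r.val = j - 1)) 1 : Tens n)
      - q • (Pi.single (fun r => decide (r.val = j)) 1 : Tens n)

/-- The span of `l_1, …, l_n`. -/
def ellSpan (n : ℕ) : Submodule Fq (Tens n) :=
  Submodule.span Fq {v : Tens n | ∃ j, 1 ≤ j ∧ j ≤ n ∧ v = ell n j}

theorem q_ne_zero : q ≠ 0 := RatFunc.X_ne_zero

/-- `U_i` acts on a family of coordinates that varies freely at the factors `i, i+1` only
through the matrix of `Ũ`. -/
theorem Uop_apply_family {n i : ℕ} (x y : Fin n) (hx : x.val + 1 = i) (hy : y.val = i)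
    (s : Bool → Bool → Fin n → Bool) (hsx : ∀ a b, s a b x = a) (hsy : ∀ a b, s a b y = b)
    (hs : ∀ r, r ≠ x → r ≠ y → ∀ a b c d, s a b r = s c d r) (ψ : Tens n) (a b : Bool) :
    Uop n i ψ (s a b) = ∑ p : Bool × Bool, uCoef p.1 p.2 a b * ψ (s p.1 p.2) := by
  have hi : 1 ≤ i ∧ i < n := by omega
  have ex : (⟨i - 1, by omega⟩ : Fin n) = x := Fin.ext (by simp; omega)
  have ey : (⟨i, hi.2⟩ : Fin n) = y := Fin.ext hy.symm
  have upd : ∀ c d, Function.update (Function.update (s a b) x c) y d = s c d := by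
    intro c d
    funext r
    by_cases hry : r = y
    · subst hry; simp [hsy]
    by_cases hrx : r = x
    · subst hrx; simp [hry, hsx]
    · simp [hry, hrx, hs r hrx hry a b c d]
  simp only [Uop, Matrix.mulVecLin_apply, Matrix.mulVec, dotProduct, locMat, dif_pos hi, ex, ey,
    upd, hsx, hsy]
  symm
  refine Finset.sum_of_injOn (fun p : Bool × Bool => s p.1 p.2) ?_ (by simp) ?_ ?_
  · rintro ⟨c, d⟩ - ⟨c', d'⟩ - h
    have h1 := congrFun h x
    have h2 := congrFun h y
    simp only [hsx, hsy] at h1 h2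
    rw [h1, h2]
  · intro u _ hu
    rw [if_neg, zero_mul]
    exact fun h => hu ⟨(u x, u y), by simp, h.symm⟩
  · rintro ⟨c, d⟩ -
    simp [hsx, hsy]

theorem Uop_comp_self {n i : ℕ} (h1 : 1 ≤ i) (h2 : i < n) :
    Uop n i ∘ₗ Uop n i = (-(q + q⁻¹)) • Uop n i := by
  refine LinearMap.ext fun ψ => funext fun t => ?_
  let x : Fin n := ⟨i - 1, by omega⟩
  let y : Fin n := ⟨i, h2⟩
  have hxy : x ≠ y := by simp [x, y, Fin.ext_iff]; omega
  let s : Bool → Bool → Fin n → Bool := fun a b r => if r = x then a else if r = y then b else t r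
  have ht : s (t x) (t y) = t := by
    funext r; simp only [s]; split_ifs <;> simp_all
  have key := Uop_apply_family x y (i := i) (by simp [x]; omega) rfl s (by simp [s])
    (by simp [s, hxy.symm]) (by intro r h h'; simp [s, h, h'])
  have hq := q_ne_zero
  rw [← ht]
  generalize t x = a
  generalize t y = b
  simp only [LinearMap.comp_apply, LinearMap.smul_apply, Pi.smul_apply, smul_eq_mul, key,
    Fintype.sum_prod_type, Fintype.sum_bool]
  cases a <;> cases b <;> simp only [uCoef] <;> field_simp <;> ring

theorem Uop_comm {n i j : ℕ} (hi : 1 ≤ i) (hj : j < n) (hij : i + 1 < j) :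
    Uop n i ∘ₗ Uop n j = Uop n j ∘ₗ Uop n i := by
  refine LinearMap.ext fun ψ => funext fun t => ?_
  let x : Fin n := ⟨i - 1, by omega⟩
  let y : Fin n := ⟨i, by omega⟩
  let z : Fin n := ⟨j - 1, by omega⟩
  let w : Fin n := ⟨j, hj⟩
  have hxy : y ≠ x := by simp [x, y, Fin.ext_iff]; omega
  have hxz : z ≠ x := by simp [x, z, Fin.ext_iff]; omega
  have hxw : w ≠ x := by simp [x, w, Fin.ext_iff]; omega
  have hyz : z ≠ y := by simp [y, z, Fin.ext_iff]; omega
  have hyw : w ≠ y := by simp [y, w, Fin.ext_iff]; omega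
  have hzw : w ≠ z := by simp [z, w, Fin.ext_iff]; omega
  let s : Bool → Bool → Bool → Bool → Fin n → Bool := fun a b c d r =>
    if r = x then a else if r = y then b else if r = z then c else if r = w then d else t r
  have ht : s (t x) (t y) (t z) (t w) = t := by
    funext r; simp only [s]; split_ifs <;> simp_all
  have key₁ := fun ψ a b c d => Uop_apply_family x y (i := i) (by simp [x]; omega) rfl
    (fun a b => s a b c d) (by simp [s]) (by simp [s, hxy])
    (by intro r h h'; simp [s, h, h']) ψ a b
  have key₂ := fun ψ a b c d => Uop_apply_family z w (i := j) (by simp [z]; omega) rfl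
    (fun c d => s a b c d) (by simp [s, hxz, hyz]) (by simp [s, hxw, hyw, hzw])
    (by intro r h h'; simp [s, h, h']) ψ c d
  rw [← ht]
  simp only [LinearMap.comp_apply, key₁, key₂, Finset.mul_sum]
  rw [Finset.sum_comm]
  exact Finset.sum_congr rfl fun _ _ => Finset.sum_congr rfl fun _ _ => mul_left_comm _ _ _

theorem Uop_braid {n i : ℕ} (h1 : 1 ≤ i) (h2 : i + 1 < n) :
    Uop n i ∘ₗ Uop n (i + 1) ∘ₗ Uop n i = Uop n i ∧
      Uop n (i + 1) ∘ₗ Uop n i ∘ₗ Uop n (i + 1) = Uop n (i + 1) := by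
  suffices H : ∀ (ψ : Tens n) t,
      (Uop n i (Uop n (i + 1) (Uop n i ψ)) t = Uop n i ψ t) ∧
      (Uop n (i + 1) (Uop n i (Uop n (i + 1) ψ)) t = Uop n (i + 1) ψ t) from
    ⟨LinearMap.ext fun ψ => funext fun t => (H ψ t).1,
      LinearMap.ext fun ψ => funext fun t => (H ψ t).2⟩
  intro ψ t
  let x : Fin n := ⟨i - 1, by omega⟩
  let y : Fin n := ⟨i, by omega⟩
  let z : Fin n := ⟨i + 1, h2⟩
  have hxy : y ≠ x := by simp [x, y, Fin.ext_iff]; omega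
  have hxz : z ≠ x := by simp [x, z, Fin.ext_iff]; omega
  have hyz : z ≠ y := by simp [y, z, Fin.ext_iff]
  let s : Bool → Bool → Bool → Fin n → Bool := fun a b c r =>
    if r = x then a else if r = y then b else if r = z then c else t r
  have ht : s (t x) (t y) (t z) = t := by
    funext r; simp only [s]; split_ifs <;> simp_all
  have key₁ := fun ψ a b c => Uop_apply_family x y (i := i) (by simp [x]; omega) rfl
    (fun a b => s a b c) (by simp [s]) (by simp [s, hxy])
    (by intro r h h'; simp [s, h, h']) ψ a b
  have key₂ := fun ψ a b c => Uop_apply_family y z (i := i + 1) rfl rfl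
    (fun b c => s a b c) (by simp [s, hxy]) (by simp [s, hxz, hyz])
    (by intro r h h'; simp [s, h, h']) ψ b c
  have hq := q_ne_zero
  rw [← ht]
  generalize t x = a
  generalize t y = b
  generalize t z = c
  simp only [key₁, key₂, Fintype.sum_prod_type, Fintype.sum_bool]
  cases a <;> cases b <;> cases c <;> simp only [uCoef] <;> constructor <;> field_simp <;> ring

/-- the operators `U_1, …, U_{n-1}` satisfy the Temperley-Lieb relations. -/
theorem temperley_lieb_relations (n : ℕ) (hn : 2 ≤ n) :
    (∀ i, 1 ≤ i → i ≤ n - 1 →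
      Uop n i ∘ₗ Uop n i = (-(q + q⁻¹)) • Uop n i) ∧
    (∀ i j, 1 ≤ i → i ≤ n - 1 → 1 ≤ j → j ≤ n - 1 → 1 < |(i : ℤ) - (j : ℤ)| →
      Uop n i ∘ₗ Uop n j = Uop n j ∘ₗ Uop n i) ∧
    (∀ i j, 1 ≤ i → i ≤ n - 1 → 1 ≤ j → j ≤ n - 1 → |(i : ℤ) - (j : ℤ)| = 1 →
      Uop n i ∘ₗ Uop n j ∘ₗ Uop n i = Uop n i) := by
  refine ⟨fun i h1 h2 => Uop_comp_self h1 (by omega), fun i j hi hi' hj hj' h => ?_,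
    fun i j hi hi' hj hj' h => ?_⟩
  · rcases lt_abs.mp h with h | h
    · exact (Uop_comm hj (by omega) (by omega)).symm
    · exact Uop_comm hi (by omega) (by omega)
  · rcases (abs_eq zero_le_one).mp h with h | h
    · obtain rfl : i = j + 1 := by omega
      exact (Uop_braid hj (by omega)).2
    · obtain rfl : j = i + 1 := by omega
      exact (Uop_braid hi (by omega)).1
end
end

section
/- For every n ≥ 2, the operators t_1, …, t_{n−1} and t_1′, …, t_{n−1}′ on V^{⊗n} define a braid group action: (1) t_i∘t_i′ = id = t_i′∘t_i for all i; (2) t_i∘t_j = t_j∘t_i whenever |i−j| > 1; (3) t_i∘t_{i+1}∘t_i = t_{i+1}∘t_i∘t_{i+1} for 1 ≤ i ≤ n−2. -/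
set_option maxHeartbeats 1000000
set_option synthInstance.maxHeartbeats 400000

/-! Common setup: `Fq = ℚ(q)`, the tensor power `V^{⊗n}` of `V = Fq²` realized as
functions on the set of `{0,1}`-sequences (its standard basis), the Temperley-Lieb
and braid operators `U_i, t_i, t_i'`, the quantum `sl₂` operators `E, F, K^{⊗n}`,
weight spaces, quantum integers and the Jones-Wenzl operators. -/

noncomputable section

open Function in
/-- Action of a local operator on coordinate functions. -/
theorem locMat_mulVec_apply {n : ℕ} (m : Bool → Bool → Bool → Bool → Fq) {i : ℕ}
    {x y : Fin n} (hi : 1 ≤ i) (hx : x.val = i - 1) (hy : y.val = i) (f : Tens n)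
    (t : Fin n → Bool) :
    (locMat n m i).mulVecLin f t =
      ∑ p : Bool × Bool, m p.1 p.2 (t x) (t y) * f (update (update t x p.1) y p.2) := by
  have hxy : x ≠ y := by
    rintro rfl
    omega
  have hin : 1 ≤ i ∧ i < n := ⟨hi, hy ▸ y.isLt⟩
  have hin' : i - 1 < n := hx ▸ x.isLt
  obtain rfl : x = ⟨i - 1, hin'⟩ := Fin.ext hx
  obtain rfl : y = ⟨i, hin.2⟩ := Fin.ext hy
  simp only [Matrix.mulVecLin_apply, Matrix.mulVec, dotProduct, locMat, hin, and_self, dite_true,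
    ite_mul, zero_mul]
  rw [← Finset.sum_filter]
  symm
  refine Finset.sum_bij' (fun p _ => update (update t ⟨i - 1, hin'⟩ p.1) ⟨i, hin.2⟩ p.2)
    (fun s _ => (s ⟨i - 1, hin'⟩, s ⟨i, hin.2⟩)) ?_ ?_ ?_ ?_ ?_
  · simp [update_of_ne hxy]
  · simp
  · simp [update_of_ne hxy]
  · intro s hs
    exact (Finset.mem_filter.1 hs).2.symm
  · simp [update_of_ne hxy]

open Function in
theorem tOp_comp_tpOp {n i : ℕ} (hi : 1 ≤ i) (hin : i < n) :
    tOp n i ∘ₗ tpOp n i = LinearMap.id := by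
  have hq := q_ne_zero
  let x : Fin n := ⟨i - 1, by omega⟩
  let y : Fin n := ⟨i, hin⟩
  have hxy : x ≠ y := by simp [x, y]; omega
  refine LinearMap.ext fun f => funext fun t => ?_
  obtain ⟨P, hP, hPt⟩ : ∃ P : Bool → Bool → Fin n → Bool,
      (∀ a b, P a b = update (update t x a) y b) ∧ t = P (t x) (t y) :=
    ⟨_, fun _ _ => rfl, by simp⟩
  have px a b : P a b x = a := by simp [hP, update_of_ne hxy]
  have py a b : P a b y = b := by simp [hP]
  have pu a b c d : update (update (P a b) x c) y d = P c d := by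
    simp [hP, update_comm hxy.symm]
  rw [hPt]
  generalize t x = a
  generalize t y = b
  simp only [LinearMap.comp_apply, tOp, tpOp, locMat_mulVec_apply (x := x) (y := y) _ hi rfl rfl,
    px, py, pu, Fintype.sum_prod_type, Fintype.sum_bool, LinearMap.id_apply]
  cases a <;> cases b <;> simp [tCoef, tpCoef] <;> field_simp
  ring

open Function in
theorem tOp_comm {n i j : ℕ} (hi : 1 ≤ i) (hij : i + 1 < j) (hjn : j < n) :
    tOp n i ∘ₗ tOp n j = tOp n j ∘ₗ tOp n i := by
  let x : Fin n := ⟨i - 1, by omega⟩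
  let y : Fin n := ⟨i, by omega⟩
  let z : Fin n := ⟨j - 1, by omega⟩
  let w : Fin n := ⟨j, hjn⟩
  have hxz : x ≠ z := by simp [x, z]; omega
  have hxw : x ≠ w := by simp [x, w]; omega
  have hyz : y ≠ z := by simp [y, z]; omega
  have hyw : y ≠ w := by simp [y, w]; omega
  refine LinearMap.ext fun f => funext fun t => ?_
  simp only [LinearMap.comp_apply, tOp, locMat_mulVec_apply (x := x) (y := y) _ hi rfl rfl,
    locMat_mulVec_apply (x := z) (y := w) _ (by omega : 1 ≤ j) rfl rfl,
    update_of_ne hxz, update_of_ne hxw, update_of_ne hyz, update_of_ne hyw,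
    update_of_ne hxz.symm, update_of_ne hxw.symm, update_of_ne hyz.symm, update_of_ne hyw.symm,
    Finset.mul_sum]
  rw [Finset.sum_comm]
  refine Finset.sum_congr rfl fun p _ => Finset.sum_congr rfl fun r _ => ?_
  rw [update_comm hyz, update_comm hxz, update_comm hyw, update_comm hxw]
  ring

open Function in
theorem tOp_braid {n i : ℕ} (hi : 1 ≤ i) (hin : i + 1 < n) :
    tOp n i ∘ₗ tOp n (i + 1) ∘ₗ tOp n i = tOp n (i + 1) ∘ₗ tOp n i ∘ₗ tOp n (i + 1) := by
  let x : Fin n := ⟨i - 1, by omega⟩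
  let y : Fin n := ⟨i, by omega⟩
  let z : Fin n := ⟨i + 1, hin⟩
  have hxy : x ≠ y := by simp [x, y]; omega
  have hxz : x ≠ z := by simp only [x, z, ne_eq, Fin.mk.injEq]; omega
  have hyz : y ≠ z := by simp [y, z]
  refine LinearMap.ext fun f => funext fun t => ?_
  obtain ⟨P, hP, hPt⟩ : ∃ P : Bool → Bool → Bool → Fin n → Bool,
      (∀ a b c, P a b c = update (update (update t x a) y b) z c) ∧ t = P (t x) (t y) (t z) :=
    ⟨_, fun _ _ _ => rfl, by simp⟩
  have px a b c : P a b c x = a := by simp [hP, update_of_ne hxy, update_of_ne hxz]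
  have py a b c : P a b c y = b := by simp [hP, update_of_ne hyz]
  have pz a b c : P a b c z = c := by simp [hP]
  have pxy a b c a' b' : update (update (P a b c) x a') y b' = P a' b' c := by
    simp [hP, update_comm hxy.symm, update_comm hxz.symm, update_comm hyz.symm]
  have pyz a b c b' c' : update (update (P a b c) y b') z c' = P a b' c' := by
    simp [hP, update_comm hyz.symm]
  rw [hPt]
  generalize t x = a
  generalize t y = b
  generalize t z = c
  simp only [LinearMap.comp_apply, tOp, locMat_mulVec_apply (x := x) (y := y) _ hi rfl rfl,
    locMat_mulVec_apply (x := y) (y := z) _ (by omega : 1 ≤ i + 1) rfl rfl,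
    px, py, pz, pxy, pyz, Fintype.sum_prod_type, Fintype.sum_bool]
  cases a <;> cases b <;> cases c <;> simp [tCoef] <;> ring

/-- the operators `t_1, …, t_{n-1}` and `t_1′, …, t_{n-1}′` define a braid
group action on `V^{⊗n}`. -/
theorem braid_group_action (n : ℕ) (hn : 2 ≤ n) :
    (∀ i, 1 ≤ i → i ≤ n - 1 →
      tOp n i ∘ₗ tpOp n i = (LinearMap.id : Module.End Fq (Tens n)) ∧
      tpOp n i ∘ₗ tOp n i = (LinearMap.id : Module.End Fq (Tens n))) ∧
    (∀ i j, 1 ≤ i → i ≤ n - 1 → 1 ≤ j → j ≤ n - 1 → 1 < |(i : ℤ) - (j : ℤ)| →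
      tOp n i ∘ₗ tOp n j = tOp n j ∘ₗ tOp n i) ∧
    (∀ i, 1 ≤ i → i ≤ n - 2 →
      tOp n i ∘ₗ tOp n (i + 1) ∘ₗ tOp n i = tOp n (i + 1) ∘ₗ tOp n i ∘ₗ tOp n (i + 1)) := by
  refine ⟨fun i hi hin => ?_, fun i j hi hin hj hjn hij => ?_, fun i hi hin => ?_⟩
  · have h := tOp_comp_tpOp hi (show i < n by omega)
    exact ⟨h, (LinearMap.comp_eq_id_comm _ _).1 h⟩
  · rcases lt_abs.1 hij with h | h
    · exact (tOp_comm hj (by omega) (by omega)).symm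
    · exact tOp_comm hi (by omega) (by omega)
  · exact tOp_braid hi (by omega)
end
end

section
/- Let k be a field, n ≥ 1 and 1 ≤ m ≤ n. In the ring S := k[x,y]/(x^n, y^m), set f := x − y and g := Σ_{j=0}^{n−1} x^j y^{n−1−j}. Then: (a) the k-algebra homomorphism ε : S → k[z]/(z^m) determined by x ↦ z and y ↦ z is well defined and surjective, and its kernel equals the principal ideal f·S; (b) the annihilator of f equals g·S, i.e. {s ∈ S : f·s = 0} = g·S; (c) the annihilator of g equals f·S, i.e. {s ∈ S : g·s = 0} = f·S. Equivalently, the 2-periodic complex ⋯ → S →^{·g} S →^{·f} S →^{ε} k[z]/(z^m) → 0 is exact. -/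
set_option maxHeartbeats 1000000
set_option synthInstance.maxHeartbeats 400000

noncomputable section

open MvPolynomial

/-- The ring `S = k[x,y]/(xⁿ, yᵐ)`, with `x = X 0` and `y = X 1`. -/
abbrev Sring (k : Type*) [Field k] (n m : ℕ) :=
  MvPolynomial (Fin 2) k ⧸
    (Ideal.span {(X 0 : MvPolynomial (Fin 2) k) ^ n, (X 1 : MvPolynomial (Fin 2) k) ^ m})

/-- The ring `k[z]/(zᵐ)`. -/
abbrev Tring (k : Type*) [Field k] (m : ℕ) :=
  Polynomial k ⧸ (Ideal.span {(Polynomial.X : Polynomial k) ^ m})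

/-- The element `f = x - y` of `S`. -/
def fEl (k : Type*) [Field k] (n m : ℕ) : Sring k n m :=
  Ideal.Quotient.mk _ ((X 0 : MvPolynomial (Fin 2) k) - X 1)

/-- The element `g = Σ_{j=0}^{n-1} xʲ y^{n-1-j}` of `S`. -/
def gEl (k : Type*) [Field k] (n m : ℕ) : Sring k n m :=
  Ideal.Quotient.mk _
    (∑ j ∈ Finset.range n, (X 0 : MvPolynomial (Fin 2) k) ^ j * (X 1) ^ (n - 1 - j))

namespace BimoduleResolution

variable {k : Type*} [Field k]

/-- Restriction to the diagonal, `k[x,y] → k[z]` with `x, y ↦ z`. -/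
def diag (k : Type*) [Field k] : MvPolynomial (Fin 2) k →ₐ[k] Polynomial k :=
  aeval fun _ => Polynomial.X

/-- The section `k[z] → k[x,y]` of `diag` with `z ↦ y`. -/
def sec (k : Type*) [Field k] : Polynomial k →ₐ[k] MvPolynomial (Fin 2) k :=
  Polynomial.aeval (X 1)

@[simp] lemma diag_X (i : Fin 2) : diag k (X i) = Polynomial.X := by simp [diag]

@[simp] lemma sec_X : sec k Polynomial.X = X 1 := by simp [sec]

lemma X_sub_X_dvd_sub_sec_diag (p : MvPolynomial (Fin 2) k) :
    (X 0 - X 1 : MvPolynomial (Fin 2) k) ∣ p - sec k (diag k p) := by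
  have h : Ideal.Quotient.mkₐ k (Ideal.span {(X 0 - X 1 : MvPolynomial (Fin 2) k)}) =
      (Ideal.Quotient.mkₐ k _).comp ((sec k).comp (diag k)) := by
    ext i
    fin_cases i
    · simp only [AlgHom.comp_apply, Fin.zero_eta, diag_X, sec_X, Ideal.Quotient.mkₐ_eq_mk]
      exact Ideal.Quotient.eq.2 (Ideal.mem_span_singleton_self _)
    · simp
  rw [← Ideal.mem_span_singleton]
  exact Ideal.Quotient.eq.1 (DFunLike.congr_fun h p)

lemma X_sub_X_dvd_iff {p : MvPolynomial (Fin 2) k} :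
    (X 0 - X 1 : MvPolynomial (Fin 2) k) ∣ p ↔ diag k p = 0 := by
  refine ⟨?_, fun h => by simpa [h] using X_sub_X_dvd_sub_sec_diag p⟩
  rintro ⟨q, rfl⟩
  simp

lemma X_sub_X_ne_zero : (X 0 - X 1 : MvPolynomial (Fin 2) k) ≠ 0 :=
  sub_ne_zero.2 fun h => zero_ne_one (X_injective h)

/-- The polynomial `Σ_{j<n} xʲ y^{n-1-j}`. -/
abbrev geom (k : Type*) [Field k] (n : ℕ) : MvPolynomial (Fin 2) k :=
  ∑ j ∈ Finset.range n, (X 0 : MvPolynomial (Fin 2) k) ^ j * (X 1) ^ (n - 1 - j)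

lemma X_sub_X_mul_geom (n : ℕ) :
    (X 0 - X 1 : MvPolynomial (Fin 2) k) * geom k n = X 0 ^ n - X 1 ^ n :=
  (Commute.all _ _).mul_geom_sum₂ n

/-- The map `k[x,y] → k[y][x]`. -/
def toIterated (k : Type*) [Field k] :
    MvPolynomial (Fin 2) k →ₐ[k] Polynomial (Polynomial k) :=
  aeval ![Polynomial.X, Polynomial.C Polynomial.X]

@[simp] lemma toIterated_X_zero : toIterated k (X 0) = Polynomial.X := by simp [toIterated]

@[simp] lemma toIterated_X_one : toIterated k (X 1) = Polynomial.C Polynomial.X := by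
  simp [toIterated]

lemma toIterated_sec (r : Polynomial k) : toIterated k (sec k r) = Polynomial.C r := by
  have h : (toIterated k).comp (sec k) = Polynomial.CAlgHom := by
    ext
    simp
  exact DFunLike.congr_fun h r

lemma coeff_toIterated_geom {n : ℕ} (hn : 1 ≤ n) :
    (toIterated k (geom k n)).coeff (n - 1) = 1 := by
  simp only [map_sum, map_mul, map_pow, toIterated_X_zero, toIterated_X_one,
    Polynomial.finsetSum_coeff]
  simp only [← Polynomial.C_pow, Polynomial.coeff_mul_C, Polynomial.coeff_X_pow]
  rw [Finset.sum_eq_single (n - 1)]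
  · simp
  · intro j _ hj
    simp [hj.symm]
  · intro h
    exact absurd (Finset.mem_range.2 (by omega)) h

/-- The ideal `(xⁿ, yᵐ)` of `k[x,y]`. -/
abbrev relIdeal (k : Type*) [Field k] (n m : ℕ) : Ideal (MvPolynomial (Fin 2) k) :=
  Ideal.span {X 0 ^ n, X 1 ^ m}

lemma mk_mem_span_mk {R : Type*} [CommRing R] {I : Ideal R} {a p : R} :
    Ideal.Quotient.mk I p ∈ Ideal.span {Ideal.Quotient.mk I a} ↔ ∃ c, p - c * a ∈ I := by
  rw [Ideal.mem_span_singleton']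
  constructor
  · rintro ⟨c, hc⟩
    obtain ⟨c, rfl⟩ := Ideal.Quotient.mk_surjective c
    exact ⟨c, Ideal.Quotient.eq.1 (by rw [← hc, map_mul])⟩
  · rintro ⟨c, hc⟩
    exact ⟨Ideal.Quotient.mk I c, by rw [← map_mul, Ideal.Quotient.eq.2 hc]⟩

variable {n m : ℕ}

lemma X_pow_dvd_diag (hmn : m ≤ n) {p : MvPolynomial (Fin 2) k} (hp : p ∈ relIdeal k n m) :
    Polynomial.X ^ m ∣ diag k p := by
  obtain ⟨a, b, rfl⟩ := Ideal.mem_span_pair.1 hp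
  simp only [map_add, map_mul, map_pow, diag_X]
  exact dvd_add ((pow_dvd_pow _ hmn).mul_left _) (dvd_mul_left _ _)

lemma mk_mem_span_fEl_iff (hmn : m ≤ n) {p : MvPolynomial (Fin 2) k} :
    Ideal.Quotient.mk (relIdeal k n m) p ∈ Ideal.span {fEl k n m} ↔
      Polynomial.X ^ m ∣ diag k p := by
  rw [fEl, mk_mem_span_mk]
  constructor
  · rintro ⟨c, hc⟩
    simpa using X_pow_dvd_diag hmn hc
  · rintro ⟨r, hr⟩
    obtain ⟨q, hq⟩ := X_sub_X_dvd_sub_sec_diag p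
    refine ⟨q, Ideal.mem_span_pair.2 ⟨0, sec k r, ?_⟩⟩
    rw [hr, map_mul, map_pow, sec_X] at hq
    linear_combination -hq

lemma X_sub_X_mul_geom_mem (hmn : m ≤ n) :
    (X 0 - X 1 : MvPolynomial (Fin 2) k) * geom k n ∈ relIdeal k n m := by
  rw [X_sub_X_mul_geom]
  refine Ideal.mem_span_pair.2 ⟨1, -X 1 ^ (n - m), ?_⟩
  rw [neg_mul, pow_sub_mul_pow _ hmn]
  ring

lemma fEl_mul_gEl (hmn : m ≤ n) : fEl k n m * gEl k n m = 0 := by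
  rw [fEl, gEl, ← map_mul]
  exact Ideal.Quotient.eq_zero_iff_mem.2 (X_sub_X_mul_geom_mem hmn)

lemma fEl_mul_eq_zero_iff (hmn : m ≤ n) (s : Sring k n m) :
    fEl k n m * s = 0 ↔ s ∈ Ideal.span {gEl k n m} := by
  constructor
  · obtain ⟨p, rfl⟩ := Ideal.Quotient.mk_surjective s
    rw [fEl, ← map_mul, Ideal.Quotient.eq_zero_iff_mem, gEl, mk_mem_span_mk,
      Ideal.mem_span_pair]
    rintro ⟨a, b, hab⟩
    have hb : (X 0 - X 1 : MvPolynomial (Fin 2) k) ∣ b + a * X 1 ^ (n - m) := by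
      rw [X_sub_X_dvd_iff]
      have h := congrArg (diag k) hab
      simp only [map_add, map_mul, map_pow, map_sub, diag_X, sub_self, zero_mul] at h ⊢
      rw [← pow_sub_mul_pow _ hmn] at h
      refine (mul_eq_zero.1 (?_ : _ * Polynomial.X ^ m = 0)).resolve_right
        (pow_ne_zero _ Polynomial.X_ne_zero)
      linear_combination h
    obtain ⟨c, hc⟩ := hb
    refine ⟨a, Ideal.mem_span_pair.2 ⟨0, c, mul_left_cancel₀ X_sub_X_ne_zero ?_⟩⟩
    have hpow := pow_sub_mul_pow (X 1 : MvPolynomial (Fin 2) k) hmn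
    linear_combination hab - X 1 ^ m * hc + a * X_sub_X_mul_geom (k := k) n + a * hpow
  · rw [Ideal.mem_span_singleton']
    rintro ⟨c, rfl⟩
    rw [mul_left_comm, fEl_mul_gEl hmn, mul_zero]

lemma X_pow_dvd_of_sec_mul_geom_mem (hn : 1 ≤ n) {r : Polynomial k}
    (h : sec k r * geom k n ∈ relIdeal k n m) : Polynomial.X ^ m ∣ r := by
  obtain ⟨a, b, hab⟩ := Ideal.mem_span_pair.1 h
  have h := congrArg (fun p => (toIterated k p).coeff (n - 1)) hab
  simp only [map_add, map_mul, map_pow, toIterated_sec, Polynomial.coeff_add,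
    Polynomial.coeff_C_mul, coeff_toIterated_geom hn, toIterated_X_zero, toIterated_X_one,
    Polynomial.coeff_mul_X_pow'] at h
  simp only [← Polynomial.C_pow, Polynomial.coeff_mul_C] at h
  rw [if_neg (by omega), zero_add, mul_one] at h
  exact ⟨_, by rw [← h, mul_comm]⟩

lemma gEl_mul_eq_zero_iff (hn : 1 ≤ n) (hmn : m ≤ n) (s : Sring k n m) :
    gEl k n m * s = 0 ↔ s ∈ Ideal.span {fEl k n m} := by
  constructor
  · obtain ⟨p, rfl⟩ := Ideal.Quotient.mk_surjective s
    rw [gEl, ← map_mul, Ideal.Quotient.eq_zero_iff_mem, mk_mem_span_fEl_iff hmn]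
    intro h
    obtain ⟨q, hq⟩ := X_sub_X_dvd_sub_sec_diag p
    refine X_pow_dvd_of_sec_mul_geom_mem hn ?_
    have e : sec k (diag k p) * geom k n =
        geom k n * p - q * ((X 0 - X 1) * geom k n) := by
      linear_combination -geom k n * hq
    rw [e]
    exact sub_mem h (Ideal.mul_mem_left _ _ (X_sub_X_mul_geom_mem hmn))
  · rw [Ideal.mem_span_singleton']
    rintro ⟨c, rfl⟩
    rw [mul_left_comm, mul_comm (gEl k n m), fEl_mul_gEl hmn, mul_zero]

/-- The augmentation `ε : k[x,y]/(xⁿ, yᵐ) → k[z]/(zᵐ)` with `x, y ↦ z`. -/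
def augmentation (k : Type*) [Field k] {n m : ℕ} (hmn : m ≤ n) :
    Sring k n m →ₐ[k] Tring k m :=
  Ideal.Quotient.liftₐ _ ((Ideal.Quotient.mkₐ k _).comp (diag k)) fun _ hp =>
    Ideal.Quotient.eq_zero_iff_mem.2 (Ideal.mem_span_singleton.2 (X_pow_dvd_diag hmn hp))

lemma augmentation_mk (hmn : m ≤ n) (p : MvPolynomial (Fin 2) k) :
    augmentation k hmn (Ideal.Quotient.mk _ p) = Ideal.Quotient.mk _ (diag k p) :=
  rfl

lemma eq_augmentation (hmn : m ≤ n) (ε : Sring k n m →ₐ[k] Tring k m)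
    (h0 : ε (Ideal.Quotient.mk _ (X 0)) = Ideal.Quotient.mk _ Polynomial.X)
    (h1 : ε (Ideal.Quotient.mk _ (X 1)) = Ideal.Quotient.mk _ Polynomial.X) :
    ε = augmentation k hmn := by
  refine Ideal.Quotient.algHom_ext _ (MvPolynomial.algHom_ext fun i => ?_)
  fin_cases i
  · simpa [augmentation_mk] using h0
  · simpa [augmentation_mk] using h1

lemma augmentation_surjective (hmn : m ≤ n) : Function.Surjective (augmentation k hmn) := by
  intro t
  obtain ⟨r, rfl⟩ := Ideal.Quotient.mk_surjective t
  refine ⟨Ideal.Quotient.mk _ (sec k r), ?_⟩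
  have h : (diag k).comp (sec k) = AlgHom.id k _ := by
    ext
    simp
  rw [augmentation_mk]
  exact congrArg _ (DFunLike.congr_fun h r)

lemma ker_augmentation (hmn : m ≤ n) :
    RingHom.ker (augmentation k hmn : Sring k n m →+* Tring k m) =
      Ideal.span {fEl k n m} := by
  ext s
  obtain ⟨p, rfl⟩ := Ideal.Quotient.mk_surjective s
  rw [mk_mem_span_fEl_iff hmn, RingHom.mem_ker, ← Ideal.mem_span_singleton]
  exact Ideal.Quotient.eq_zero_iff_mem

end BimoduleResolution

open BimoduleResolution in
/-- in `S = k[x,y]/(xⁿ, yᵐ)` with `1 ≤ m ≤ n`, `f = x - y` and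
`g = Σ_{j=0}^{n-1} xʲ y^{n-1-j}`: (a) the `k`-algebra homomorphism `ε : S → k[z]/(zᵐ)`
with `x ↦ z`, `y ↦ z` is well defined (and uniquely determined), is surjective, and its
kernel is the principal ideal `(f)`; (b) the annihilator of `f` is `(g)`; (c) the
annihilator of `g` is `(f)`.  Equivalently, the 2-periodic complex
`⋯ → S →^{·g} S →^{·f} S →^{ε} k[z]/(zᵐ) → 0` is exact. -/
theorem bimodule_resolution_exact (k : Type*) [Field k] (n m : ℕ)
    (hm : 1 ≤ m) (hmn : m ≤ n) :
    (∃! ε : Sring k n m →ₐ[k] Tring k m,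
      ε (Ideal.Quotient.mk _ (X 0)) = Ideal.Quotient.mk _ Polynomial.X ∧
      ε (Ideal.Quotient.mk _ (X 1)) = Ideal.Quotient.mk _ Polynomial.X) ∧
    (∀ ε : Sring k n m →ₐ[k] Tring k m,
      ε (Ideal.Quotient.mk _ (X 0)) = Ideal.Quotient.mk _ Polynomial.X →
      ε (Ideal.Quotient.mk _ (X 1)) = Ideal.Quotient.mk _ Polynomial.X →
      Function.Surjective ε ∧
        RingHom.ker (ε : Sring k n m →+* Tring k m) = Ideal.span {fEl k n m}) ∧
    {s : Sring k n m | fEl k n m * s = 0}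
      = ((Ideal.span {gEl k n m} : Ideal (Sring k n m)) : Set (Sring k n m)) ∧
    {s : Sring k n m | gEl k n m * s = 0}
      = ((Ideal.span {fEl k n m} : Ideal (Sring k n m)) : Set (Sring k n m)) := by
  refine ⟨⟨augmentation k hmn, ⟨by simp [augmentation_mk], by simp [augmentation_mk]⟩,
    fun ε h => eq_augmentation hmn ε h.1 h.2⟩, fun ε h0 h1 => ?_,
    Set.ext (fEl_mul_eq_zero_iff hmn), Set.ext (gEl_mul_eq_zero_iff (hm.trans hmn) hmn)⟩
  obtain rfl := eq_augmentation hmn ε h0 h1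
  exact ⟨augmentation_surjective hmn, ker_augmentation hmn⟩
end
end

section
/- Let k be a field of prime characteristic p and let n ≥ 1 satisfy p ∣ n−1. Let C := k[x]/(x^n) with the k-linear derivation ∂ determined by ∂(x) = x² (so ∂(x^a) = a·x^{a+1}), and let I := (x) ⊆ C be the augmentation ideal. Then ∂(I) ⊆ I, ∂^p = 0 on C, and I is an acyclic p-complex: for every 1 ≤ i ≤ p−1, ker(∂^i) ∩ I = ∂^{p−i}(I). Consequently the augmentation map C → k sending x to 0 is a quasi-isomorphism of p-complexes. -/
set_option maxHeartbeats 1000000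
set_option synthInstance.maxHeartbeats 400000

noncomputable section

/-- The matrix of the derivation `∂` of `C = k[x]/(xⁿ)` with `∂(x) = x²`, i.e.
`∂(x^a) = a·x^{a+1}` (truncated at `xⁿ = 0`), in the basis `1, x, …, x^{n-1}`. -/
def truncDerMat (k : Type*) [Field k] (n : ℕ) : Matrix (Fin n) (Fin n) k :=
  fun b a => if b.val = a.val + 1 then (a.val : k) else 0

/-- The derivation `∂` on `C = k[x]/(xⁿ)` (coordinates w.r.t. the basis `x^a`). -/
def truncDer (k : Type*) [Field k] (n : ℕ) : ((Fin n → k) →ₗ[k] (Fin n → k)) :=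
  (truncDerMat k n).mulVecLin

/-- The augmentation ideal `I = (x) ⊆ C = k[x]/(xⁿ)`: the span of `x, x², …, x^{n-1}`. -/
def augIdeal (k : Type*) [Field k] (n : ℕ) : Set (Fin n → k) :=
  {v | ∀ j : Fin n, j.val = 0 → v j = 0}

/-- The element `1 = x⁰` of `C = k[x]/(xⁿ)`. -/
def oneVec (k : Type*) [Field k] (n : ℕ) : Fin n → k :=
  fun j => if j.val = 0 then 1 else 0

/-- The coefficient `a (a + 1) ⋯ (a + i - 1)` of `∂^i (x^a)`. -/
def iterCoeff (k : Type*) [Field k] (a i : ℕ) : k :=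
  ∏ t ∈ Finset.range i, ((a + t : ℕ) : k)

lemma iterCoeff_eq_zero_iff {k : Type*} [Field k] (p : ℕ) [CharP k p] (a i : ℕ) :
    iterCoeff k a i = 0 ↔ ∃ t < i, p ∣ a + t := by
  simp only [iterCoeff, Finset.prod_eq_zero_iff, Finset.mem_range, CharP.cast_eq_zero_iff k p]

lemma truncDer_apply_succ {k : Type*} [Field k] {n : ℕ} (v : Fin n → k) (a : ℕ)
    (h : a + 1 < n) :
    truncDer k n v ⟨a + 1, h⟩ = (a : k) * v ⟨a, by omega⟩ := by
  simp only [truncDer, truncDerMat, Matrix.mulVecLin_apply, Matrix.mulVec, dotProduct]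
  rw [Finset.sum_eq_single ⟨a, by omega⟩]
  · simp
  · intro b _ hb
    rw [if_neg, zero_mul]
    intro h'
    exact hb (Fin.ext (by simpa using h'.symm))
  · simp

lemma truncDer_apply_zero {k : Type*} [Field k] {n : ℕ} (v : Fin n → k) (h : 0 < n) :
    truncDer k n v ⟨0, h⟩ = 0 := by
  simp [truncDer, truncDerMat, Matrix.mulVec, dotProduct]

lemma truncDer_iterate_apply_add {k : Type*} [Field k] {n : ℕ} (v : Fin n → k) (a i : ℕ)
    (h : a + i < n) :
    (⇑(truncDer k n))^[i] v ⟨a + i, h⟩ = iterCoeff k a i * v ⟨a, by omega⟩ := by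
  induction i with
  | zero => simp [iterCoeff]
  | succ i ih =>
    rw [Function.iterate_succ_apply']
    refine (truncDer_apply_succ _ (a + i) h).trans ?_
    rw [ih, iterCoeff, iterCoeff, Finset.prod_range_succ]
    ring

lemma truncDer_iterate_apply_of_lt {k : Type*} [Field k] {n : ℕ} (v : Fin n → k) (b i : ℕ)
    (h : b < n) (hb : b < i) : (⇑(truncDer k n))^[i] v ⟨b, h⟩ = 0 := by
  induction i generalizing b with
  | zero => omega
  | succ i ih =>
    rw [Function.iterate_succ_apply']
    cases b with
    | zero => exact truncDer_apply_zero _ h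
    | succ b => rw [truncDer_apply_succ, ih b (by omega) (by omega), mul_zero]

lemma truncDer_iterate_char {k : Type*} [Field k] {p : ℕ} (hp : p.Prime) [CharP k p] {n : ℕ}
    (v : Fin n → k) : (⇑(truncDer k n))^[p] v = 0 := by
  funext ⟨b, hb⟩
  rcases lt_or_ge b p with h | h
  · exact truncDer_iterate_apply_of_lt v b p hb h
  · obtain ⟨a, rfl⟩ := Nat.exists_eq_add_of_le' h
    rw [truncDer_iterate_apply_add, (iterCoeff_eq_zero_iff p a p).2, zero_mul, Pi.zero_apply]
    have hlt := Nat.mod_lt a hp.pos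
    rcases Nat.eq_zero_or_pos (a % p) with h0 | h0
    · exact ⟨0, hp.pos, Nat.dvd_of_mod_eq_zero h0⟩
    · refine ⟨p - a % p, by omega, a / p + 1, ?_⟩
      have := Nat.div_add_mod a p
      rw [mul_add, mul_one]
      omega

lemma truncDer_iterate_oneVec {k : Type*} [Field k] {n i : ℕ} (hi : 1 ≤ i) :
    (⇑(truncDer k n))^[i] (oneVec k n) = 0 := by
  funext ⟨b, hb⟩
  rcases lt_or_ge b i with h | h
  · exact truncDer_iterate_apply_of_lt _ b i hb h
  · obtain ⟨a, rfl⟩ := Nat.exists_eq_add_of_le' h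
    rw [truncDer_iterate_apply_add]
    rcases Nat.eq_zero_or_pos a with rfl | ha
    · rw [(iterCoeff_eq_zero_iff (ringChar k) 0 i).2 ⟨0, hi, by simp⟩, zero_mul, Pi.zero_apply]
    · simp [oneVec, ha.ne']

/-- If `∂^i (x^b) ≠ 0` in `k[x]` and `x^(b+i) ≠ 0`, a `∂^i`-cycle has no `x^b` term. -/
lemma apply_eq_zero_of_iterate_eq_zero {k : Type*} [Field k] {n i : ℕ} {v : Fin n → k}
    (hv : (⇑(truncDer k n))^[i] v = 0) {b : ℕ} (hb : b + i < n) (hc : iterCoeff k b i ≠ 0) :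
    v ⟨b, by omega⟩ = 0 := by
  have h := truncDer_iterate_apply_add v b i hb
  rw [hv, Pi.zero_apply] at h
  exact (mul_eq_zero.1 h.symm).resolve_left hc

lemma exists_iterate_eq_of_cycle {k : Type*} [Field k] {p : ℕ} [CharP k p] {n : ℕ}
    (hn : 1 ≤ n) (hdvd : p ∣ n - 1) {i : ℕ} (hip : i < p) {v : Fin n → k}
    (hvI : v ∈ augIdeal k n) (hv : (⇑(truncDer k n))^[i] v = 0) :
    ∃ w ∈ augIdeal k n, (⇑(truncDer k n))^[p - i] w = v := by
  obtain ⟨q, hq⟩ := hdvd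
  refine ⟨fun a => if h : a.val + (p - i) < n then
    (iterCoeff k a (p - i))⁻¹ * v ⟨a + (p - i), h⟩ else 0, ?_, ?_⟩
  · intro j hj
    have hc : iterCoeff k j (p - i) = 0 :=
      (iterCoeff_eq_zero_iff p _ _).2 ⟨0, by omega, by simp [hj]⟩
    simp [hc]
  · funext ⟨b, hb⟩
    rcases lt_or_ge b (p - i) with h | h
    · rw [truncDer_iterate_apply_of_lt _ b _ hb h]
      rcases Nat.eq_zero_or_pos b with rfl | hb0
      · exact (hvI _ rfl).symm
      · have hpn : p ≤ n - 1 := Nat.le_of_dvd (by omega) ⟨q, hq⟩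
        refine (apply_eq_zero_of_iterate_eq_zero hv (by omega) ?_).symm
        rw [Ne, iterCoeff_eq_zero_iff p]
        rintro ⟨t, ht, hd⟩
        have := Nat.le_of_dvd (by omega) hd
        omega
    · obtain ⟨a, rfl⟩ := Nat.exists_eq_add_of_le' h
      rw [truncDer_iterate_apply_add, dif_pos hb]
      by_cases hc : iterCoeff k a (p - i) = 0
      · obtain ⟨t, ht, m, hm⟩ := (iterCoeff_eq_zero_iff p _ _).1 hc
        have hmq : m < q := by
          by_contra! hle
          have := Nat.mul_le_mul_left p hle
          omega
        have hle := Nat.mul_le_mul_left p (Nat.succ_le_of_lt hmq)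
        rw [Nat.mul_succ] at hle
        rw [hc, zero_mul]
        refine (apply_eq_zero_of_iterate_eq_zero hv (by omega) ?_).symm
        rw [Ne, iterCoeff_eq_zero_iff p]
        rintro ⟨s, hs, hd⟩
        have hd' := (Nat.dvd_sub hd ⟨m, hm⟩)
        have := Nat.le_of_dvd (by omega) hd'
        omega
      · rw [mul_inv_cancel_left₀ hc]

lemma truncDer_iterate_mem_augIdeal {k : Type*} [Field k] {n : ℕ} {v : Fin n → k} {i : ℕ}
    (hi : 1 ≤ i) : (⇑(truncDer k n))^[i] v ∈ augIdeal k n := fun j hj =>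
  truncDer_iterate_apply_of_lt v j i j.2 (by omega)

lemma truncDer_iterate_iterate_sub {k : Type*} [Field k] {p : ℕ} (hp : p.Prime) [CharP k p]
    {n i : ℕ} (hi : i ≤ p) (w : Fin n → k) :
    (⇑(truncDer k n))^[i] ((⇑(truncDer k n))^[p - i] w) = 0 := by
  rw [← Function.iterate_add_apply, Nat.add_sub_cancel' hi, truncDer_iterate_char hp]

/-- for `k` of prime characteristic `p` and `p ∣ n - 1`, the derivation
`∂` of `C = k[x]/(xⁿ)` with `∂(x) = x²` preserves the augmentation ideal `I = (x)`,
satisfies `∂^p = 0`, and `I` is an acyclic `p`-complex: `ker(∂^i) ∩ I = ∂^{p-i}(I)` for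
every `1 ≤ i ≤ p - 1`.  Consequently the augmentation map `C → k`, `x ↦ 0`, is a
quasi-isomorphism of `p`-complexes: on each slash homology, the class of `1` generates
(every `∂^i`-cycle is `c·1 + ∂^{p-i}(w)`) and injects (`c·1 ∈ im ∂^{p-i}` only for
`c = 0`). -/
theorem augmentation_ideal_acyclic (k : Type*) [Field k] (p : ℕ) (hp : p.Prime)
    [CharP k p] (n : ℕ) (hn : 1 ≤ n) (hdvd : p ∣ (n - 1)) :
    (∀ v ∈ augIdeal k n, truncDer k n v ∈ augIdeal k n) ∧
    (∀ v : Fin n → k, (⇑(truncDer k n))^[p] v = 0) ∧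
    (∀ i : ℕ, 1 ≤ i → i ≤ p - 1 →
      {v | v ∈ augIdeal k n ∧ (⇑(truncDer k n))^[i] v = 0}
        = (⇑(truncDer k n))^[p - i] '' augIdeal k n) ∧
    (∀ i : ℕ, 1 ≤ i → i ≤ p - 1 →
      (∀ v : Fin n → k, (⇑(truncDer k n))^[i] v = 0 ↔
        ∃ (c : k) (w : Fin n → k), v = c • oneVec k n + (⇑(truncDer k n))^[p - i] w) ∧
      (∀ c : k, (∃ w, c • oneVec k n = (⇑(truncDer k n))^[p - i] w) → c = 0)) := by
  have hp0 := hp.pos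
  refine ⟨fun v _ => truncDer_iterate_mem_augIdeal (i := 1) le_rfl,
    truncDer_iterate_char hp, fun i h1 h2 => ?_, fun i h1 h2 => ⟨fun v => ⟨fun hv => ?_, ?_⟩, ?_⟩⟩
  · ext v
    constructor
    · rintro ⟨hvI, hv⟩
      exact exists_iterate_eq_of_cycle hn hdvd (by omega) hvI hv
    · rintro ⟨w, -, rfl⟩
      exact ⟨truncDer_iterate_mem_augIdeal (by omega),
        truncDer_iterate_iterate_sub hp (by omega) w⟩
  · obtain ⟨w, -, hw⟩ := exists_iterate_eq_of_cycle (i := i)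
      (v := v - v ⟨0, hn⟩ • oneVec k n) hn hdvd (by omega)
      (fun j hj => by
        obtain rfl : j = ⟨0, hn⟩ := Fin.ext hj
        simp [oneVec])
      (by rw [← Module.End.coe_pow, map_sub, map_smul, Module.End.coe_pow, hv,
            truncDer_iterate_oneVec h1, smul_zero, sub_zero])
    exact ⟨v ⟨0, hn⟩, w, by rw [hw]; abel⟩
  · rintro ⟨c, w, rfl⟩
    have h := truncDer_iterate_iterate_sub hp (show i ≤ p by omega) w
    have h' := truncDer_iterate_oneVec (k := k) (n := n) h1
    rw [← Module.End.coe_pow] at h h' ⊢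
    rw [map_add, map_smul, h, h', smul_zero, add_zero]
  · rintro c ⟨w, hw⟩
    have h := congrFun hw ⟨0, hn⟩
    rw [truncDer_iterate_apply_of_lt w 0 _ hn (by omega)] at h
    simpa [oneVec] using h
end
end
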